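/- For μ ∈ P_A^∞ define ω_μ := {(μ_1⋯μ_k)·ν⁻¹ ∈ 𝔽_n : k ≥ 0, ν ∈ 𝔽_n^+ an admissible word (possibly empty) such that the word obtained by appending the letter μ_{k+1} to ν is admissible}. Then ω_μ satisfies conditions (S1)–(S4), and ω_μ ∩ 𝔽_n^+ = {e} ∪ {μ_1⋯μ_k : k ≥ 1}. -/

import Mathlib

/-- The positive word `g_{i_1} ⋯ g_{i_k} ∈ 𝔽_n` associated to a list of letters. -/
def wordToF {n : ℕ} (l : List (Fin n)) : FreeGroup (Fin n) :=
  (l.map FreeGroup.of).prod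

/-- A word is admissible for the matrix `a` if consecutive letters `i, j` satisfy
`a i j = 1`; the empty word and single letters are admissible. -/
def AdmissibleWord {n : ℕ} (a : Fin n → Fin n → Bool) (l : List (Fin n)) : Prop :=
  l.Chain' (fun i j => a i j = true)

/-- Conditions (S1)–(S4) on a subset `ω ⊆ 𝔽_n`. -/
def SCond {n : ℕ} (a : Fin n → Fin n → Bool) (ω : Set (FreeGroup (Fin n))) : Prop :=
  (1 : FreeGroup (Fin n)) ∈ ω ∧
  (∀ t r : FreeGroup (Fin n), t * r ∈ ω →
    FreeGroup.norm (t * r) = FreeGroup.norm t + FreeGroup.norm r → t ∈ ω) ∧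
  (∀ t ∈ ω, ∃! j : Fin n, t * FreeGroup.of j ∈ ω) ∧
  (∀ t ∈ ω, ∀ i j : Fin n, t * FreeGroup.of j ∈ ω →
    (t * (FreeGroup.of i)⁻¹ ∈ ω ↔ a i j = true))

/-- The group element `μ_1 μ_2 ⋯ μ_k ∈ 𝔽_n` (`k = 0` gives the identity);
the path `μ` is indexed from `0`, so `μ_{k}` in 1-indexed notation is `μ (k-1)`. -/
def prefWord {n : ℕ} (μ : ℕ → Fin n) (k : ℕ) : FreeGroup (Fin n) :=
  wordToF ((List.range k).map μ)

/-- `𝔽_n^+`, the positive words, as a subset of `𝔽_n`. -/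
def FnPlus (n : ℕ) : Set (FreeGroup (Fin n)) :=
  {x | ∃ l : List (Fin n), x = wordToF l}

/-- `ω_μ = { (μ_1⋯μ_k) ν⁻¹ : k ≥ 0, ν admissible with ν·μ_{k+1} admissible }`. -/
def omegaMu {n : ℕ} (a : Fin n → Fin n → Bool) (μ : ℕ → Fin n) :
    Set (FreeGroup (Fin n)) :=
  {t | ∃ (k : ℕ) (ν : List (Fin n)),
    AdmissibleWord a ν ∧ AdmissibleWord a (ν ++ [μ k]) ∧
    t = prefWord μ k * (wordToF ν)⁻¹}

lemma FreeGroup.isReduced_map_const_sign {α : Type*} (b : Bool) (l : List α) :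
    FreeGroup.IsReduced (l.map fun i => (i, b)) := by
  unfold FreeGroup.IsReduced
  rw [List.isChain_map]
  exact (List.pairwise_of_forall (by simp)).isChain

section PositiveWords

variable {n : ℕ}

lemma wordToF_eq_mk (l : List (Fin n)) :
    wordToF l = FreeGroup.mk (l.map fun i => (i, true)) := by
  induction l with
  | nil => rfl
  | cons i l ih =>
    have h : wordToF (i :: l) = FreeGroup.of i * wordToF l := by simp [wordToF]
    rw [h, ih, FreeGroup.of, FreeGroup.mul_mk]
    rfl

lemma wordToF_append (l l' : List (Fin n)) : wordToF (l ++ l') = wordToF l * wordToF l' := by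
  simp [wordToF]

lemma wordToF_cons (i : Fin n) (l : List (Fin n)) :
    wordToF (i :: l) = FreeGroup.of i * wordToF l := by
  simp [wordToF]

lemma wordToF_injective : Function.Injective (wordToF (n := n)) := by
  have h : ∀ l : List (Fin n), (wordToF l).toWord = l.map fun i => (i, true) := fun l => by
    rw [wordToF_eq_mk, FreeGroup.toWord_mk]
    exact (FreeGroup.isReduced_map_const_sign true l).reduce_eq
  intro l l' hl
  have h' := congrArg FreeGroup.toWord hl
  rw [h, h] at h'
  exact List.map_injective_iff.2 (fun i j hij => congrArg Prod.fst hij) h'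

/-- The (possibly non-reduced) word of signed letters spelling `μ_1 ⋯ μ_k ν⁻¹`. -/
def signedWord (μ : ℕ → Fin n) (k : ℕ) (ν : List (Fin n)) : List (Fin n × Bool) :=
  (List.range k).map (fun i => (μ i, true)) ++ ν.reverse.map fun i => (i, false)

lemma mk_signedWord (μ : ℕ → Fin n) (k : ℕ) (ν : List (Fin n)) :
    FreeGroup.mk (signedWord μ k ν) = prefWord μ k * (wordToF ν)⁻¹ := by
  simp only [signedWord, prefWord, wordToF_eq_mk, FreeGroup.inv_mk, FreeGroup.mul_mk,
    FreeGroup.invRev, List.map_map, List.map_reverse]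
  rfl

lemma prefWord_succ (μ : ℕ → Fin n) (k : ℕ) :
    prefWord μ (k + 1) = prefWord μ k * FreeGroup.of (μ k) := by
  simp [prefWord, wordToF, List.range_succ]

lemma prefWord_mul_inv_eq_succ (μ : ℕ → Fin n) (k : ℕ) (ν : List (Fin n)) :
    prefWord μ k * (wordToF ν)⁻¹ = prefWord μ (k + 1) * (wordToF (ν ++ [μ k]))⁻¹ := by
  rw [prefWord_succ, wordToF_append]
  simp [wordToF]

end PositiveWords

section Omega

variable {n : ℕ} {a : Fin n → Fin n → Bool} {μ : ℕ → Fin n} {t : FreeGroup (Fin n)}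

lemma mem_omegaMu_iff :
    t ∈ omegaMu a μ ↔ ∃ (k : ℕ) (ν : List (Fin n)),
      AdmissibleWord a (ν ++ [μ k]) ∧ t = prefWord μ k * (wordToF ν)⁻¹ :=
  ⟨fun ⟨k, ν, _, h, e⟩ => ⟨k, ν, h, e⟩, fun ⟨k, ν, h, e⟩ =>
    ⟨k, ν, List.IsChain.left_of_append h, h, e⟩⟩

/-- Every element of `ω_μ` is spelled by a word `μ_1 ⋯ μ_k ν⁻¹` for all large `k`. -/
lemma exists_rep_of_mem_omegaMu (hμ : ∀ j : ℕ, a (μ j) (μ (j + 1)) = true)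
    (ht : t ∈ omegaMu a μ) :
    ∃ k₀, ∀ k ≥ k₀, ∃ ν, AdmissibleWord a (ν ++ [μ k]) ∧
      t = prefWord μ k * (wordToF ν)⁻¹ := by
  obtain ⟨k₀, ν₀, h₀, e₀⟩ := mem_omegaMu_iff.1 ht
  refine ⟨k₀, fun k hk => ?_⟩
  induction k, hk using Nat.le_induction with
  | base => exact ⟨ν₀, h₀, e₀⟩
  | succ k _ ih =>
    obtain ⟨ν, h, e⟩ := ih
    refine ⟨ν ++ [μ k], ?_, e.trans (prefWord_mul_inv_eq_succ μ k ν)⟩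
    unfold AdmissibleWord at h ⊢
    refine List.isChain_append.2 ⟨h, List.isChain_singleton _, ?_⟩
    simp [hμ k]

lemma exists_cons_rep_of_mem_omegaMu (hμ : ∀ j : ℕ, a (μ j) (μ (j + 1)) = true)
    (ht : t ∈ omegaMu a μ) :
    ∃ k₀, ∀ k ≥ k₀, ∃ i ν, AdmissibleWord a (i :: ν ++ [μ k]) ∧
      t = prefWord μ k * (wordToF (i :: ν))⁻¹ := by
  obtain ⟨k₀, h⟩ := exists_rep_of_mem_omegaMu hμ ht
  refine ⟨k₀ + 1, fun k hk => ?_⟩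
  obtain ⟨k, rfl⟩ : ∃ m, k = m + 1 := ⟨k - 1, by omega⟩
  obtain ⟨ν, hν, e⟩ := h k (by omega)
  obtain ⟨i, ν', hi⟩ := List.exists_cons_of_ne_nil (l := ν ++ [μ k]) (by simp)
  refine ⟨i, ν', ?_, ?_⟩
  · rw [← hi]
    refine List.isChain_append.2 ⟨hν, List.isChain_singleton _, ?_⟩
    simp [hμ k]
  · rw [← hi, ← prefWord_mul_inv_eq_succ, e]

/-- Every element of `ω_μ` is spelled by a reduced word `μ_1 ⋯ μ_k ν⁻¹`. -/
lemma exists_reduced_rep_of_mem_omegaMu (ht : t ∈ omegaMu a μ) :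
    ∃ (k : ℕ) (ν : List (Fin n)), AdmissibleWord a (ν ++ [μ k]) ∧
      t.toWord = signedWord μ k ν := by
  obtain ⟨k, ν, h, e⟩ := mem_omegaMu_iff.1 ht
  clear ht
  induction k generalizing ν with
  | zero =>
    refine ⟨0, ν, h, ?_⟩
    rw [e, ← mk_signedWord, FreeGroup.toWord_mk]
    exact (FreeGroup.isReduced_map_const_sign false ν.reverse).reduce_eq
  | succ k ih =>
    by_cases hν : ∃ ν', ν = ν' ++ [μ k]
    · obtain ⟨ν', rfl⟩ := hν
      exact ih ν' (List.IsChain.left_of_append h) (by rw [e, ← prefWord_mul_inv_eq_succ])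
    · refine ⟨k + 1, ν, h, ?_⟩
      rw [e, ← mk_signedWord, FreeGroup.toWord_mk]
      refine FreeGroup.IsReduced.reduce_eq ?_
      unfold signedWord FreeGroup.IsReduced
      rw [List.isChain_append]
      refine ⟨?_, FreeGroup.isReduced_map_const_sign false ν.reverse, ?_⟩
      · have h' := FreeGroup.isReduced_map_const_sign true ((List.range (k + 1)).map μ)
        rwa [List.map_map] at h'
      · rcases List.eq_nil_or_concat ν with rfl | ⟨ν', i, rfl⟩
        · simp
        · have hi : i ≠ μ k := by
            rintro rfl
            exact hν ⟨ν', List.concat_eq_append⟩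
          simp [List.range_succ, hi.symm]

lemma mem_omegaMu_of_norm_mul {r : FreeGroup (Fin n)} (h : t * r ∈ omegaMu a μ)
    (hn : FreeGroup.norm (t * r) = FreeGroup.norm t + FreeGroup.norm r) :
    t ∈ omegaMu a μ := by
  obtain ⟨k, ν, hν, e⟩ := exists_reduced_rep_of_mem_omegaMu h
  have hw : (t * r).toWord = t.toWord ++ r.toWord :=
    (FreeGroup.toWord_mul_sublist t r).eq_of_length (by simpa [FreeGroup.norm] using hn)
  rw [hw, signedWord, List.append_eq_append_iff] at e
  rw [mem_omegaMu_iff]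
  rcases e with ⟨s, hs, -⟩ | ⟨s, hs, hs'⟩
  · obtain ⟨l₁, l₂, hl, h₁, -⟩ := List.map_eq_append_iff.1 hs
    have hl₁ : l₁ = List.range l₁.length := by
      have hp : l₁ <+: List.range k := ⟨l₂, hl.symm⟩
      have h₁ := List.prefix_iff_eq_take.1 hp
      have h₂ := hp.length_le
      rw [List.take_range] at h₁
      rw [List.length_range] at h₂
      rwa [min_eq_left h₂] at h₁
    refine ⟨l₁.length, [], List.isChain_singleton _, ?_⟩
    rw [← mk_signedWord, ← FreeGroup.mk_toWord (x := t), ← h₁, signedWord, ← hl₁]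
    simp
  · obtain ⟨l₁, l₂, hl, h₁, -⟩ := List.map_eq_append_iff.1 hs'
    have hl' : ν = l₂.reverse ++ l₁.reverse := by
      rw [← List.reverse_append, ← hl, List.reverse_reverse]
    refine ⟨k, l₁.reverse, ?_, ?_⟩
    · rw [hl', List.append_assoc] at hν
      exact List.IsChain.right_of_append hν
    · rw [← mk_signedWord, ← FreeGroup.mk_toWord (x := t), hs, signedWord, List.reverse_reverse, h₁]

lemma eq_of_mul_of_mem_omegaMu (hμ : ∀ j : ℕ, a (μ j) (μ (j + 1)) = true) {j : Fin n}
    (h : t * FreeGroup.of j ∈ omegaMu a μ) :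
    ∃ k₀, ∀ k ≥ k₀, ∀ ν, t = prefWord μ k * (wordToF ν)⁻¹ → ∃ ν', ν = j :: ν' := by
  obtain ⟨k₀, h₀⟩ := exists_rep_of_mem_omegaMu hμ h
  refine ⟨k₀, fun k hk ν e => ?_⟩
  obtain ⟨ν', -, e'⟩ := h₀ k hk
  refine ⟨ν', wordToF_injective ?_⟩
  rw [e, mul_assoc, mul_right_inj, ← inv_inj] at e'
  rw [wordToF_cons, ← inv_inv (wordToF ν'), ← e']
  simp

lemma existsUnique_mul_of_mem_omegaMu (hμ : ∀ j : ℕ, a (μ j) (μ (j + 1)) = true)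
    (ht : t ∈ omegaMu a μ) : ∃! j : Fin n, t * FreeGroup.of j ∈ omegaMu a μ := by
  obtain ⟨k₀, h₀⟩ := exists_cons_rep_of_mem_omegaMu hμ ht
  obtain ⟨i, ν, hν, e⟩ := h₀ k₀ le_rfl
  have hi : t * FreeGroup.of i ∈ omegaMu a μ :=
    mem_omegaMu_iff.2 ⟨k₀, ν, List.IsChain.tail hν, by rw [e, wordToF_cons]; group⟩
  refine ⟨i, hi, fun j hj => ?_⟩
  obtain ⟨k₁, h₁⟩ := eq_of_mul_of_mem_omegaMu hμ hi
  obtain ⟨k₂, h₂⟩ := eq_of_mul_of_mem_omegaMu hμ hj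
  obtain ⟨m, ν, -, e⟩ := h₀ (max k₀ (max k₁ k₂)) (by simp)
  obtain ⟨ν₁, e₁⟩ := h₁ _ (by simp) _ e
  obtain ⟨ν₂, e₂⟩ := h₂ _ (by simp) _ e
  exact (List.cons.inj (e₂.symm.trans e₁)).1

lemma mul_inv_mem_omegaMu_iff (hμ : ∀ j : ℕ, a (μ j) (μ (j + 1)) = true)
    (ht : t ∈ omegaMu a μ) {i j : Fin n} (hj : t * FreeGroup.of j ∈ omegaMu a μ) :
    t * (FreeGroup.of i)⁻¹ ∈ omegaMu a μ ↔ a i j = true := by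
  obtain ⟨k₀, h₀⟩ := exists_rep_of_mem_omegaMu hμ ht
  obtain ⟨k₁, h₁⟩ := eq_of_mul_of_mem_omegaMu hμ hj
  constructor
  · intro h
    obtain ⟨k₂, h₂⟩ := exists_rep_of_mem_omegaMu hμ h
    obtain ⟨ν, -, e⟩ := h₀ (max k₀ (max k₁ k₂)) (by simp)
    obtain ⟨ν', rfl⟩ := h₁ _ (by simp) _ e
    obtain ⟨ν₂, hν₂, e₂⟩ := h₂ (max k₀ (max k₁ k₂)) (by simp)
    have : ν₂ = i :: j :: ν' := by
      apply wordToF_injective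
      rw [e, mul_assoc, mul_right_inj, ← mul_inv_rev, inv_inj, ← wordToF_cons] at e₂
      exact e₂.symm
    subst this
    exact (List.isChain_cons_cons.1 hν₂).1
  · intro h
    obtain ⟨ν, hν, e⟩ := h₀ (max k₀ k₁) (by simp)
    obtain ⟨ν', rfl⟩ := h₁ _ (by simp) _ e
    refine mem_omegaMu_iff.2 ⟨_, i :: j :: ν', List.isChain_cons_cons.2 ⟨h, hν⟩, ?_⟩
    rw [e, wordToF_cons i, mul_inv_rev, mul_assoc]

lemma prefWord_mem_omegaMu (k : ℕ) : prefWord μ k ∈ omegaMu a μ :=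
  mem_omegaMu_iff.2 ⟨k, [], List.isChain_singleton _, by simp [wordToF]⟩

lemma exists_eq_prefWord_of_mem_omegaMu (h : t ∈ omegaMu a μ) (h' : t ∈ FnPlus n) :
    ∃ k, t = prefWord μ k := by
  obtain ⟨k, ν, -, e⟩ := mem_omegaMu_iff.1 h
  obtain ⟨l, rfl⟩ := h'
  rw [eq_mul_inv_iff_mul_eq, ← wordToF_append] at e
  have hp : l <+: (List.range k).map μ := ⟨ν, wordToF_injective e⟩
  have h₁ := List.prefix_iff_eq_take.1 hp
  refine ⟨min l.length k, ?_⟩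
  rw [← List.map_take, List.take_range] at h₁
  rw [prefWord, ← h₁]

end Omega

/-- for an infinite admissible path `μ ∈ P_A^∞`, the set `ω_μ` satisfies
conditions (S1)–(S4), and `ω_μ ∩ 𝔽_n^+ = {e} ∪ {μ_1⋯μ_k : k ≥ 1}`. -/
theorem stmt_14 (n : ℕ) (hn : 1 ≤ n) (a : Fin n → Fin n → Bool)
    (hA : ∀ i, ∃ j, a i j = true)
    (μ : ℕ → Fin n) (hμ : ∀ j : ℕ, a (μ j) (μ (j + 1)) = true) :
    SCond a (omegaMu a μ) ∧
      omegaMu a μ ∩ FnPlus n =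
        {1} ∪ {x | ∃ k : ℕ, 1 ≤ k ∧ x = prefWord μ k} := by
  refine ⟨⟨?_, fun t r h hn => mem_omegaMu_of_norm_mul h hn,
    fun t ht => existsUnique_mul_of_mem_omegaMu hμ ht,
    fun t ht i j hj => mul_inv_mem_omegaMu_iff hμ ht hj⟩, ?_⟩
  · exact prefWord_mem_omegaMu (μ := μ) 0
  · ext x
    constructor
    · rintro ⟨h, h'⟩
      obtain ⟨k, rfl⟩ := exists_eq_prefWord_of_mem_omegaMu h h'
      rcases Nat.eq_zero_or_pos k with rfl | hk
      · exact Or.inl rfl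
      · exact Or.inr ⟨k, hk, rfl⟩
    · rintro (rfl | ⟨k, -, rfl⟩)
      · exact ⟨prefWord_mem_omegaMu (μ := μ) 0, [], rfl⟩
      · exact ⟨prefWord_mem_omegaMu k, _, rfl⟩
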